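/- arXiv:2504.13158 — 3 statements merged into one kernel-verified Lean document; each statement's English description precedes it below -/
import Mathlib

section
/- Under the Smith–Scott model, the probability of making the point 6 using the AB set, p_AB(6,θ)/(p_AB(6,θ)+p_AB(7,θ)), equals 5/11 at θ=0 and 3/5 at θ=1, and for every θ ∈ (0,1] and every other dice set UV ∈ {AA, AC, BB, BC, CC}, p_AB(6,θ)/(p_AB(6,θ)+p_AB(7,θ)) > p_UV(6,θ)/(p_UV(6,θ)+p_UV(7,θ)). -/
/-- The three on-axis face sets of the Smith–Scott model. -/
def ssA : Finset ℕ := {2, 3, 4, 5}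
def ssB : Finset ℕ := {1, 3, 4, 6}
def ssC : Finset ℕ := {1, 2, 5, 6}

/-- Distribution of dice totals for fair dice. -/
noncomputable def pSS (x : ℕ) : ℝ := (6 - |(x : ℝ) - 7|) / 36

/-- Distribution of dice totals under perfect control with set `U`–`V`. -/
noncomputable def pUV (U V : Finset ℕ) (x : ℕ) : ℝ :=
  (((U ×ˢ V).filter (fun p => p.1 + p.2 = x)).card : ℝ) / 16

/-- Smith–Scott model distribution of dice totals with control parameter `θ`. -/
noncomputable def pUVθ (U V : Finset ℕ) (x : ℕ) (θ : ℝ) : ℝ :=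
  (1 - θ) * pSS x + θ * pUV U V x

/-- Probability of making the point `x` with dice set `U`–`V`. -/
noncomputable def makePoint (U V : Finset ℕ) (x : ℕ) (θ : ℝ) : ℝ :=
  pUVθ U V x θ / (pUVθ U V x θ + pUVθ U V 7 θ)

lemma pSS_six : pSS 6 = 5 / 36 := by
  norm_num [pSS]

lemma pSS_seven : pSS 7 = 1 / 6 := by
  norm_num [pSS]

lemma pUV_eq_of_card_eq {U V : Finset ℕ} {x n : ℕ}
    (h : ((U ×ˢ V).filter (fun p => p.1 + p.2 = x)).card = n) :
    pUV U V x = n / 16 := by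
  rw [pUV, h]

lemma pUV_AB_six : pUV ssA ssB 6 = 3 / 16 :=
  pUV_eq_of_card_eq (n := 3) (by decide)

lemma pUV_AB_seven : pUV ssA ssB 7 = 2 / 16 :=
  pUV_eq_of_card_eq (n := 2) (by decide)

lemma div_add_lt_div_add_of_mul_lt_mul {a b c d : ℝ} (hab : 0 < a + b) (hcd : 0 < c + d)
    (h : c * b < a * d) : c / (c + d) < a / (a + b) := by
  rw [div_lt_div_iff₀ hcd hab]
  linarith

/-- The `AB` set beats any set with at most three ways to roll 6 and at least two ways to
roll 7, provided one of these bounds is strict. -/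
lemma makePoint_six_lt_AB {U V : Finset ℕ} {n m : ℕ}
    (hn : ((U ×ˢ V).filter (fun p => p.1 + p.2 = 6)).card = n)
    (hm : ((U ×ˢ V).filter (fun p => p.1 + p.2 = 7)).card = m)
    (hn₀ : 0 < n) (hn₃ : n ≤ 3) (hm₂ : 2 ≤ m) (hne : n < 3 ∨ 2 < m)
    {θ : ℝ} (hθ : θ ∈ Set.Ioc (0 : ℝ) 1) :
    makePoint U V 6 θ < makePoint ssA ssB 6 θ := by
  obtain ⟨h₀, h₁⟩ := hθ
  have hs : 0 ≤ 1 - θ := sub_nonneg.mpr h₁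
  have hnpos : (0 : ℝ) < n := by exact_mod_cast hn₀
  have hn' : (n : ℝ) ≤ 3 := by exact_mod_cast hn₃
  have hm' : (2 : ℝ) ≤ m := by exact_mod_cast hm₂
  simp only [makePoint, pUVθ, pSS_six, pSS_seven, pUV_AB_six, pUV_AB_seven,
    pUV_eq_of_card_eq hn, pUV_eq_of_card_eq hm]
  have hc : 0 < (1 - θ) * (5 / 36) + θ * (n / 16) := by positivity
  have hb : 0 < (1 - θ) * (1 / 6) + θ * (2 / 16) := by positivity
  have hca : (1 - θ) * (5 / 36) + θ * (n / 16) ≤ (1 - θ) * (5 / 36) + θ * (3 / 16) := by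
    gcongr
  have hbd : (1 - θ) * (1 / 6) + θ * (2 / 16) ≤ (1 - θ) * (1 / 6) + θ * (m / 16) := by
    gcongr
  have ha := hc.trans_le hca
  have hd := hb.trans_le hbd
  apply div_add_lt_div_add_of_mul_lt_mul (add_pos ha hb) (add_pos hc hd)
  rcases hne with h | h
  · have h' : (n : ℝ) < 3 := by exact_mod_cast h
    exact mul_lt_mul (by gcongr) hbd hb ha.le
  · have h' : (2 : ℝ) < m := by exact_mod_cast h
    exact mul_lt_mul' hca (by gcongr) hb.le ha

/-- Under the Smith–Scott model, the probability of making the point 6 with the `AB`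
set equals `5/11` at `θ = 0` and `3/5` at `θ = 1`, and for `θ ∈ (0,1]` it strictly
exceeds the corresponding probability for every other dice set. -/
theorem smith_scott_point6_AB_optimal :
    makePoint ssA ssB 6 0 = 5 / 11 ∧
    makePoint ssA ssB 6 1 = 3 / 5 ∧
    (∀ θ ∈ Set.Ioc (0 : ℝ) 1,
      makePoint ssA ssB 6 θ > makePoint ssA ssA 6 θ ∧
      makePoint ssA ssB 6 θ > makePoint ssA ssC 6 θ ∧
      makePoint ssA ssB 6 θ > makePoint ssB ssB 6 θ ∧
      makePoint ssA ssB 6 θ > makePoint ssB ssC 6 θ ∧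
      makePoint ssA ssB 6 θ > makePoint ssC ssC 6 θ) := by
  refine ⟨?_, ?_, fun θ hθ => ⟨?_, ?_, ?_, ?_, ?_⟩⟩
  · norm_num [makePoint, pUVθ, pSS_six, pSS_seven]
  · norm_num [makePoint, pUVθ, pUV_AB_six, pUV_AB_seven]
  · exact makePoint_six_lt_AB (n := 3) (m := 4) (by decide) (by decide)
      (by simp) (by simp) (by simp) (by simp) hθ
  · exact makePoint_six_lt_AB (n := 2) (m := 2) (by decide) (by decide)
      (by simp) (by simp) (by simp) (by simp) hθ
  · exact makePoint_six_lt_AB (n := 1) (m := 4) (by decide) (by decide)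
      (by simp) (by simp) (by simp) (by simp) hθ
  · exact makePoint_six_lt_AB (n := 2) (m := 2) (by decide) (by decide)
      (by simp) (by simp) (by simp) (by simp) hθ
  · exact makePoint_six_lt_AB (n := 2) (m := 4) (by decide) (by decide)
      (by simp) (by simp) (by simp) (by simp) hθ
end

section
/- Under the Smith–Scott model, for every θ ∈ [0,1], with M_θ = (I₄ − Q_θ)⁻¹, the variance of the length of the shooter's hand satisfies [(2M_θ − I₄)·M_θ·𝟙]_co − ((M_θ·𝟙)_co)² = 24(44+θ)(27441664 + 4461696θ − 441024θ² − 34064θ³ + 5652θ⁴ − 174θ⁵ + θ⁶)/((4−θ)²(8+θ)²(28−θ)⁴). -/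
/-- Smith–Scott Markov chain transition matrix, states `(co, p4-10, p5-9, p6-8, 7o)`. -/
noncomputable def ssP (θ : ℝ) : Matrix (Fin 5) (Fin 5) ℝ :=
  (1 / 144 : ℝ) •
    !![12 * (4 - θ), 6 * (4 - θ), 4 * (8 + θ), 2 * (20 + 7 * θ), 0;
       6 * (2 + θ), 108, 0, 0, 6 * (4 - θ);
       2 * (8 + θ), 0, 4 * (26 + θ), 0, 6 * (4 - θ);
       20 + 7 * θ, 0, 0, 100 - θ, 6 * (4 - θ);
       0, 0, 0, 0, 144]

/-- Upper-left `4 × 4` submatrix of `ssP θ` (transient states). -/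
noncomputable def ssQ (θ : ℝ) : Matrix (Fin 4) (Fin 4) ℝ :=
  (ssP θ).submatrix Fin.castSucc Fin.castSucc

/-- The fundamental matrix `M_θ = (I₄ − Q_θ)⁻¹`. -/
noncomputable def ssM (θ : ℝ) : Matrix (Fin 4) (Fin 4) ℝ := (1 - ssQ θ)⁻¹

/-- The all-ones vector `𝟙 = (1,1,1,1)ᵀ`. -/
def onesVec : Fin 4 → ℝ := fun _ => 1

lemma one_sub_ssQ (θ : ℝ) :
    1 - ssQ θ = (1 / 144 : ℝ) •
      !![96 + 12 * θ, -(6 * (4 - θ)), -(4 * (8 + θ)), -(2 * (20 + 7 * θ));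
         -(6 * (2 + θ)), 36, 0, 0;
         -(2 * (8 + θ)), 0, 4 * (10 - θ), 0;
         -(20 + 7 * θ), 0, 0, 44 + θ] := by
  ext i j
  fin_cases i <;> fin_cases j <;> simp [ssQ, ssP] <;> ring

lemma det_one_sub_ssQ (θ : ℝ) :
    (1 - ssQ θ).det = (4 - θ) * (8 + θ) * (28 - θ) ^ 2 / 144 ^ 3 := by
  rw [one_sub_ssQ, Matrix.det_smul]
  simp [Matrix.det_succ_row_zero, Fin.sum_univ_succ, Fin.succAbove]
  ring

/-- If `1 - ssQ θ` is invertible, a solution of `(1 - ssQ θ) x = b` is `ssM θ` applied to `b`. -/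
lemma ssM_mulVec_eq {θ : ℝ} (h : IsUnit (1 - ssQ θ).det) {x b : Fin 4 → ℝ}
    (hx : Matrix.mulVec (1 - ssQ θ) x = b) : Matrix.mulVec (ssM θ) b = x := by
  rw [← hx, ssM, Matrix.mulVec_mulVec, Matrix.nonsing_inv_mul _ h, Matrix.one_mulVec]

/-- The first entry of `ssM θ *ᵥ b`, that is, the first row of `ssM θ` in closed form. -/
lemma ssM_mulVec_zero {θ : ℝ} (h : IsUnit (1 - ssQ θ).det) (b : Fin 4 → ℝ) :
    Matrix.mulVec (ssM θ) b 0 =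
      (144 * (10 - θ) * (44 + θ) * b 0 + 24 * (4 - θ) * (10 - θ) * (44 + θ) * b 1
        + 144 * (8 + θ) * (44 + θ) * b 2 + 288 * (20 + 7 * θ) * (10 - θ) * b 3)
        / ((4 - θ) * (8 + θ) * (28 - θ) ^ 2) := by
  have hD : (4 - θ) * (8 + θ) * (28 - θ) ^ 2 ≠ 0 := by
    intro h0
    exact h.ne_zero (by rw [det_one_sub_ssQ, h0, zero_div])
  obtain ⟨x, rfl⟩ : ∃ x, Matrix.mulVec (1 - ssQ θ) x = b :=
    ⟨Matrix.mulVec (1 - ssQ θ)⁻¹ b, by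
      rw [Matrix.mulVec_mulVec, Matrix.mul_nonsing_inv _ h, Matrix.one_mulVec]⟩
  rw [ssM_mulVec_eq h rfl, eq_div_iff hD, one_sub_ssQ]
  simp [Matrix.mulVec, dotProduct, Fin.sum_univ_succ]
  ring

/-- Under the Smith–Scott model, the variance of the hand length,
`[(2M_θ − I₄) M_θ 𝟙]_co − ((M_θ 𝟙)_co)²`, equals the stated rational function of `θ`. -/
theorem smith_scott_variance_hand_length (θ : ℝ) (hθ : θ ∈ Set.Icc (0 : ℝ) 1) :
    Matrix.mulVec ((2 • ssM θ - 1) * ssM θ) onesVec 0 -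
      (Matrix.mulVec (ssM θ) onesVec 0) ^ 2 =
      24 * (44 + θ) * (27441664 + 4461696 * θ - 441024 * θ ^ 2 - 34064 * θ ^ 3
          + 5652 * θ ^ 4 - 174 * θ ^ 5 + θ ^ 6) /
        ((4 - θ) ^ 2 * (8 + θ) ^ 2 * (28 - θ) ^ 4) := by
  obtain ⟨h0, h1⟩ := hθ
  have h4 : 4 - θ ≠ 0 := by linarith
  have h8 : 8 + θ ≠ 0 := by linarith
  have h28 : 28 - θ ≠ 0 := by linarith
  have h10 : 10 - θ ≠ 0 := by linarith
  have h44 : 44 + θ ≠ 0 := by linarith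
  have hdet : IsUnit (1 - ssQ θ).det := by
    rw [det_one_sub_ssQ, isUnit_iff_ne_zero]
    positivity
  have hv0 := ssM_mulVec_zero hdet onesVec
  set v := Matrix.mulVec (ssM θ) onesVec with hv
  have hsys : Matrix.mulVec (1 - ssQ θ) v = onesVec := by
    rw [hv, ssM, Matrix.mulVec_mulVec, Matrix.mul_nonsing_inv _ hdet, Matrix.one_mulVec]
  rw [one_sub_ssQ] at hsys
  have hv1 : v 1 = (144 + 6 * (2 + θ) * v 0) / 36 := by
    have := congrFun hsys 1
    simp [Matrix.mulVec, dotProduct, Fin.sum_univ_succ, onesVec] at this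
    linarith
  have hv2 : v 2 = (144 + 2 * (8 + θ) * v 0) / (4 * (10 - θ)) := by
    have := congrFun hsys 2
    simp [Matrix.mulVec, dotProduct, Fin.sum_univ_succ, onesVec] at this
    rw [eq_div_iff (by simpa using h10)]
    linarith
  have hv3 : v 3 = (144 + (20 + 7 * θ) * v 0) / (44 + θ) := by
    have := congrFun hsys 3
    simp [Matrix.mulVec, dotProduct, Fin.sum_univ_succ, onesVec] at this
    rw [eq_div_iff h44]
    linarith
  have hlhs : Matrix.mulVec ((2 • ssM θ - 1) * ssM θ) onesVec 0
      = 2 * Matrix.mulVec (ssM θ) v 0 - v 0 := by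
    rw [← Matrix.mulVec_mulVec, ← hv, Matrix.sub_mulVec, Matrix.one_mulVec, Matrix.smul_mulVec]
    simp
  rw [hlhs, ssM_mulVec_zero hdet v, hv1, hv2, hv3, hv0]
  simp only [onesVec]
  field_simp
  ring
end

section
/- Under the Wong–Shackleford model, for every θ ∈ [0,1], with M_θ = (I₄ − Q_θ)⁻¹, the variance of the length of the shooter's hand satisfies [(2M_θ − I₄)·M_θ·𝟙]_co − ((M_θ·𝟙)_co)² = 9(5306103 − 5622318θ + 1933097θ² − 153376θ³ − 39214θ⁴ + 7176θ⁵ − 360θ⁶)/((3−θ)(3−2θ)²(196 − 85θ + 6θ²)²). -/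
/-- Wong–Shackleford Markov chain transition matrix, states `(co, p4-10, p5-9, p6-8, 7o)`. -/
noncomputable def wsP (θ : ℝ) : Matrix (Fin 5) (Fin 5) ℝ :=
  (1 / 36 : ℝ) •
    !![2 * (6 + θ), 2 * (3 - θ), 8, 10, 0;
       3 + θ, 3 * (9 + θ), 0, 0, 2 * (3 - 2 * θ);
       4, 0, 2 * (13 + 2 * θ), 0, 2 * (3 - 2 * θ);
       5 + θ, 0, 0, 25 + 3 * θ, 2 * (3 - 2 * θ);
       0, 0, 0, 0, 36]

/-- Upper-left `4 × 4` submatrix of `wsP θ` (transient states). -/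
noncomputable def wsQ (θ : ℝ) : Matrix (Fin 4) (Fin 4) ℝ :=
  (wsP θ).submatrix Fin.castSucc Fin.castSucc

/-- The fundamental matrix `M_θ = (I₄ − Q_θ)⁻¹`. -/
noncomputable def wsM (θ : ℝ) : Matrix (Fin 4) (Fin 4) ℝ := (1 - wsQ θ)⁻¹

/-- The first coordinate of the solution `u` of `(I₄ − Q_θ) u = r`. -/
noncomputable def wsSolCo (θ : ℝ) (r : Fin 4 → ℝ) : ℝ :=
  9 * (3 * (5 - 2 * θ) * (11 - 3 * θ) * r 0 + 2 * (5 - 2 * θ) * (11 - 3 * θ) * r 1 +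
      12 * (11 - 3 * θ) * r 2 + 30 * (5 - 2 * θ) * r 3) /
    ((3 - 2 * θ) * (196 - 85 * θ + 6 * θ ^ 2))

/-- The solution `u` of `(I₄ − Q_θ) u = r`, obtained by back substitution from `wsSolCo`. -/
noncomputable def wsSol (θ : ℝ) (r : Fin 4 → ℝ) : Fin 4 → ℝ :=
  ![wsSolCo θ r,
    (36 * r 1 + (3 + θ) * wsSolCo θ r) / (3 * (3 - θ)),
    (36 * r 2 + 4 * wsSolCo θ r) / (2 * (5 - 2 * θ)),
    (36 * r 3 + (5 + θ) * wsSolCo θ r) / (11 - 3 * θ)]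

theorem one_sub_wsQ (θ : ℝ) :
    1 - wsQ θ = (1 / 36 : ℝ) •
      !![24 - 2 * θ, -(2 * (3 - θ)), -8, -10;
         -(3 + θ), 3 * (3 - θ), 0, 0;
         -4, 0, 2 * (5 - 2 * θ), 0;
         -(5 + θ), 0, 0, 11 - 3 * θ] := by
  ext i j
  fin_cases i <;> fin_cases j <;> simp [wsQ, wsP] <;> ring

theorem wsDenominators_ne_zero {θ : ℝ} (hθ : θ ∈ Set.Icc (0 : ℝ) 1) :
    3 - θ ≠ 0 ∧ 5 - 2 * θ ≠ 0 ∧ 11 - 3 * θ ≠ 0 ∧ 3 - 2 * θ ≠ 0 ∧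
      196 - 85 * θ + 6 * θ ^ 2 ≠ 0 := by
  obtain ⟨h0, h1⟩ := hθ
  refine ⟨?_, ?_, ?_, ?_, ?_⟩ <;> apply ne_of_gt <;> nlinarith

theorem one_sub_wsQ_mulVec_wsSol {θ : ℝ} (hθ : θ ∈ Set.Icc (0 : ℝ) 1) (r : Fin 4 → ℝ) :
    Matrix.mulVec (1 - wsQ θ) (wsSol θ r) = r := by
  obtain ⟨h3, h5, h11, h32, hK⟩ := wsDenominators_ne_zero hθ
  rw [one_sub_wsQ, Matrix.smul_mulVec]
  ext i
  fin_cases i <;>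
    simp only [wsSol, Pi.smul_apply, smul_eq_mul, Matrix.mulVec, dotProduct,
      Fin.sum_univ_four, Matrix.of_apply, Matrix.cons_val, Fin.zero_eta, Fin.mk_one,
      Fin.reduceFinMk]
  simp only [wsSolCo]
  all_goals
    generalize hA : 5 - 2 * θ = A at *
    generalize hB : 11 - 3 * θ = B at *
    generalize hC : 3 - 2 * θ = C at *
    generalize hD : 3 - θ = D at *
    generalize hE : 196 - 85 * θ + 6 * θ ^ 2 = E at *
    field_simp
    subst hA hB hC hD hE
    ring

theorem wsM_mulVec {θ : ℝ} (hθ : θ ∈ Set.Icc (0 : ℝ) 1) (r : Fin 4 → ℝ) :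
    Matrix.mulVec (wsM θ) r = wsSol θ r := by
  have hunit : IsUnit (1 - wsQ θ) :=
    Matrix.mulVec_surjective_iff_isUnit.mp fun r => ⟨_, one_sub_wsQ_mulVec_wsSol hθ r⟩
  have hdet := (Matrix.isUnit_iff_isUnit_det _).mp hunit
  nth_rewrite 1 [← one_sub_wsQ_mulVec_wsSol hθ r]
  rw [wsM, Matrix.mulVec_mulVec, Matrix.nonsing_inv_mul _ hdet, Matrix.one_mulVec]

/-- Under the Wong–Shackleford model, the variance of the hand length,
`[(2M_θ − I₄) M_θ 𝟙]_co − ((M_θ 𝟙)_co)²`, equals the stated rational function of `θ`. -/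
theorem wong_shackleford_variance_hand_length (θ : ℝ) (hθ : θ ∈ Set.Icc (0 : ℝ) 1) :
    Matrix.mulVec ((2 • wsM θ - 1) * wsM θ) onesVec 0 -
      (Matrix.mulVec (wsM θ) onesVec 0) ^ 2 =
      9 * (5306103 - 5622318 * θ + 1933097 * θ ^ 2 - 153376 * θ ^ 3
          - 39214 * θ ^ 4 + 7176 * θ ^ 5 - 360 * θ ^ 6) /
        ((3 - θ) * (3 - 2 * θ) ^ 2 * (196 - 85 * θ + 6 * θ ^ 2) ^ 2) := by
  obtain ⟨h3, h5, h11, h32, hK⟩ := wsDenominators_ne_zero hθ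
  rw [← Matrix.mulVec_mulVec, Matrix.sub_mulVec, Matrix.smul_mulVec, Matrix.one_mulVec,
    wsM_mulVec hθ, wsM_mulVec hθ]
  have hco : wsSolCo θ onesVec =
      9 * (557 - 281 * θ + 30 * θ ^ 2) / ((3 - 2 * θ) * (196 - 85 * θ + 6 * θ ^ 2)) := by
    simp only [wsSolCo, onesVec]
    ring
  rw [Pi.sub_apply, Pi.smul_apply, nsmul_eq_mul]
  simp only [wsSol, Matrix.cons_val, hco]
  rw [wsSolCo]
  simp only [Matrix.cons_val, onesVec, Nat.cast_ofNat]
  generalize hA : 5 - 2 * θ = A at *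
  generalize hB : 11 - 3 * θ = B at *
  generalize hC : 3 - 2 * θ = C at *
  generalize hD : 3 - θ = D at *
  generalize hE : 196 - 85 * θ + 6 * θ ^ 2 = E at *
  field_simp
  subst hA hB hC hD hE
  ring
end
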